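/- For a positive definite symmetric matrix b with eigenvalues λ_1,…,λ_{n−1} > 0, the normalized k-th elementary symmetric function satisfies ∑_{i,j,m} (∂σ_k/∂b_{ij}) b_{im} b_{jm} ≥ k·σ_k(b)^{1+1/k}. -/

import Mathlib

open Matrix

/-- The normalized `k`-th elementary symmetric function of the eigenvalues of a
square matrix, defined via the coefficients of the characteristic polynomial,
normalized so that `σ_k(Id) = 1`. -/
noncomputable def sigmaK (m k : ℕ) (b : Fin m → Fin m → ℝ) : ℝ :=
  (-1 : ℝ) ^ k * ((Matrix.of b).charpoly.coeff (m - k)) / (m.choose k)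

open Polynomial in
theorem coeff_prod_X_sub_C_eq_sum_powersetCard {R ι : Type*} [CommRing R] [Fintype ι]
    (d : ι → R) {k : ℕ} (hk : k ≤ Fintype.card ι) :
    (∏ i, (X - C (d i))).coeff (Fintype.card ι - k) =
      (-1) ^ k * ∑ s ∈ (Finset.univ : Finset ι).powersetCard k, ∏ i ∈ s, d i := by
  have h := Multiset.prod_X_sub_C_coeff (Finset.univ.val.map d)
    (k := Fintype.card ι - k) (by simp)
  simpa [Finset.esymm_map_val, Nat.sub_sub_self hk] using h

theorem Matrix.IsHermitian.charpoly_add_smul_sq {ι : Type*} [Fintype ι] [DecidableEq ι]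
    {A : Matrix ι ι ℝ} (hA : A.IsHermitian) (t : ℝ) :
    (A + t • (A * A)).charpoly =
      ∏ i, (Polynomial.X - Polynomial.C (hA.eigenvalues i + t * hA.eigenvalues i ^ 2)) := by
  have h : A + t • (A * A) = Unitary.conjStarAlgAut ℝ _ hA.eigenvectorUnitary
      (Matrix.diagonal fun i => hA.eigenvalues i + t * hA.eigenvalues i ^ 2) := by
    conv_lhs => rw [hA.spectral_theorem]
    rw [← map_mul, ← map_smul, ← map_add]
    congr 1
    ext i j
    by_cases hij : i = j
    · subst hij; simp [Matrix.diagonal_mul_diagonal, sq]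
    · simp [Matrix.diagonal_mul_diagonal, hij]
  rw [h, Unitary.conjStarAlgAut_apply, Matrix.charpoly_mul_comm, ← mul_assoc]
  simp [Matrix.charpoly_diagonal]

theorem sigmaK_add_smul_sq {m k : ℕ} (hk : k ≤ m) {b : Fin m → Fin m → ℝ}
    (hb : (Matrix.of b).IsHermitian) (t : ℝ) :
    sigmaK m k (b + t • Matrix.of.symm (Matrix.of b * Matrix.of b)) =
      (∑ s ∈ (Finset.univ : Finset (Fin m)).powersetCard k,
        ∏ i ∈ s, (hb.eigenvalues i + t * hb.eigenvalues i ^ 2)) / m.choose k := by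
  have h : Matrix.of (b + t • Matrix.of.symm (Matrix.of b * Matrix.of b)) =
      Matrix.of b + t • (Matrix.of b * Matrix.of b) := rfl
  have hc := coeff_prod_X_sub_C_eq_sum_powersetCard
    (fun i => hb.eigenvalues i + t * hb.eigenvalues i ^ 2) (k := k) (by simpa using hk)
  rw [Fintype.card_fin] at hc
  rw [sigmaK, h, hb.charpoly_add_smul_sq, hc, ← mul_assoc, ← mul_pow]
  simp

theorem differentiable_sigmaK (m k : ℕ) : Differentiable ℝ (sigmaK m k) := by
  have h : ∀ b : Fin m → Fin m → ℝ, (Matrix.of b).charpoly.coeff (m - k) =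
      MvPolynomial.aeval (fun p : Fin m × Fin m => b p.1 p.2)
        ((Matrix.charpoly.univ ℝ (Fin m)).coeff (m - k)) := fun b =>
    (Matrix.charpoly.univ_coeff_eval₂Hom (Fin m) (RingHom.id ℝ)
      (fun p : Fin m × Fin m => b p.1 p.2) (m - k)).symm
  have hd : Differentiable ℝ fun b : Fin m → Fin m → ℝ =>
      (Matrix.of b).charpoly.coeff (m - k) := by
    simp_rw [h]
    intro b
    refine (AnalyticAt.aeval_mvPolynomial (fun p => ?_) _).differentiableAt
    exact ((ContinuousLinearMap.proj (R := ℝ) (φ := fun _ : Fin m => ℝ) p.2).comp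
      (ContinuousLinearMap.proj (R := ℝ) (φ := fun _ : Fin m => Fin m → ℝ) p.1)).analyticAt b
  exact (hd.const_mul ((-1) ^ k)).mul_const (m.choose k : ℝ)⁻¹

theorem hasDerivAt_sum_prod_add_mul_sq {ι : Type*} (S : Finset (Finset ι))
    (d : ι → ℝ) :
    HasDerivAt (fun t : ℝ => ∑ s ∈ S, ∏ i ∈ s, (d i + t * d i ^ 2))
      (∑ s ∈ S, (∏ i ∈ s, d i) * ∑ i ∈ s, d i) 0 := by
  classical
  refine HasDerivAt.fun_sum fun s _ => ?_
  have h : ∀ i ∈ s, HasDerivAt (fun t : ℝ => d i + t * d i ^ 2) (d i ^ 2) 0 := fun i _ => by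
    simpa using ((hasDerivAt_id (0 : ℝ)).mul_const (d i ^ 2)).const_add (d i)
  refine (HasDerivAt.fun_finsetProd h).congr_deriv ?_
  rw [Finset.mul_sum]
  refine Finset.sum_congr rfl fun i hi => ?_
  rw [← Finset.mul_prod_erase s d hi]
  simp
  ring

theorem mul_prod_rpow_le_prod_mul_sum {ι : Type*} (s : Finset ι) (d : ι → ℝ)
    (hd : ∀ i ∈ s, 0 < d i) (hs : s.Nonempty) :
    (s.card : ℝ) * (∏ i ∈ s, d i) ^ ((1 : ℝ) + 1 / s.card) ≤
      (∏ i ∈ s, d i) * ∑ i ∈ s, d i := by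
  have hc : (0 : ℝ) < s.card := by exact_mod_cast hs.card_pos
  have hp : 0 < ∏ i ∈ s, d i := Finset.prod_pos hd
  have h := Real.geom_mean_le_arith_mean_weighted s (fun _ => (1 : ℝ) / s.card) d
    (fun _ _ => by positivity) (by simp [hc.ne']) fun i hi => (hd i hi).le
  rw [Real.finsetProd_rpow _ _ fun i hi => (hd i hi).le, ← Finset.mul_sum,
    one_div_mul_eq_div, le_div_iff₀ hc] at h
  rw [Real.rpow_add hp, Real.rpow_one]
  nlinarith [mul_le_mul_of_nonneg_left h hp.le]

theorem mul_rpow_le_sum_prod_mul_sum {ι : Type*} [Fintype ι] (d : ι → ℝ) (hd : ∀ i, 0 < d i)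
    {k : ℕ} (hk : 1 ≤ k) (hk' : k ≤ Fintype.card ι) :
    (k : ℝ) * ((∑ s ∈ (Finset.univ : Finset ι).powersetCard k, ∏ i ∈ s, d i) /
        (Fintype.card ι).choose k) ^ ((1 : ℝ) + 1 / k) ≤
      (∑ s ∈ (Finset.univ : Finset ι).powersetCard k, (∏ i ∈ s, d i) * ∑ i ∈ s, d i) /
        (Fintype.card ι).choose k := by
  have hC : (0 : ℝ) < (Fintype.card ι).choose k := by exact_mod_cast Nat.choose_pos hk'
  have h := Real.rpow_arith_mean_le_arith_mean_rpow
    ((Finset.univ : Finset ι).powersetCard k)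
    (fun _ => ((Fintype.card ι).choose k : ℝ)⁻¹) (fun s => ∏ i ∈ s, d i)
    (fun _ _ => by positivity) (by simp [hC.ne'])
    (fun s _ => Finset.prod_nonneg fun i _ => (hd i).le)
    (p := (1 : ℝ) + 1 / k) (by simp)
  rw [← Finset.mul_sum, ← Finset.mul_sum, inv_mul_eq_div, inv_mul_eq_div] at h
  refine (mul_le_mul_of_nonneg_left h k.cast_nonneg).trans ?_
  rw [← mul_div_assoc, Finset.mul_sum]
  refine div_le_div_of_nonneg_right (Finset.sum_le_sum fun s hs => ?_) hC.le
  have hs' := (Finset.mem_powersetCard.1 hs).2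
  have := mul_prod_rpow_le_prod_mul_sum s d (fun i _ => hd i)
    (Finset.card_pos.1 (by lia))
  rwa [hs'] at this

theorem ContinuousLinearMap.apply_eq_sum_single {ι κ : Type*} [Fintype ι] [Fintype κ]
    [DecidableEq ι] [DecidableEq κ] (L : (ι → κ → ℝ) →L[ℝ] ℝ) (c : ι → κ → ℝ) :
    L c = ∑ i, ∑ j, L (Pi.single i (Pi.single j 1)) * c i j := by
  have h : c = ∑ i, ∑ j, c i j • Pi.single i (Pi.single j (1 : ℝ)) := by
    ext i j
    simp [Finset.sum_apply, Pi.single_apply, ite_apply]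
  conv_lhs => rw [h]
  simp [mul_comm]

/-- for a positive definite symmetric matrix `b` (all eigenvalues
positive), the normalized `k`-th elementary symmetric function satisfies
`∑_{i,j,m} (∂σ_k/∂b_{ij}) b_{im} b_{jm} ≥ k · σ_k(b)^{1+1/k}`,
a consequence of the inverse concavity of `σ_k^{1/k}`. -/
theorem sigmaK_inverse_concavity_ineq (n k : ℕ) (hn : 2 ≤ n) (hk1 : 1 ≤ k) (hk2 : k ≤ n - 1)
    (b : Fin (n - 1) → Fin (n - 1) → ℝ)
    (hsymm : (Matrix.of b).IsSymm)
    (hposdef : (Matrix.of b).PosDef) :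
    ∑ i, ∑ j, ∑ m, fderiv ℝ (sigmaK (n - 1) k) b (Pi.single i (Pi.single j 1)) * b i m * b j m
      ≥ (k : ℝ) * (sigmaK (n - 1) k b) ^ ((1 : ℝ) + 1 / k) := by
  have hb : (Matrix.of b).IsHermitian := hposdef.isHermitian
  set c := Matrix.of.symm (Matrix.of b * Matrix.of b) with hc
  have hentry : ∀ i j, c i j = ∑ m, b i m * b j m := fun i j => by
    rw [hc, Matrix.of_symm_apply, Matrix.mul_apply]
    exact Finset.sum_congr rfl fun m _ => by rw [hsymm.apply j m]; rfl
  have hsum : ∑ i, ∑ j, ∑ m, fderiv ℝ (sigmaK (n - 1) k) b (Pi.single i (Pi.single j 1)) *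
      b i m * b j m = fderiv ℝ (sigmaK (n - 1) k) b c := by
    rw [ContinuousLinearMap.apply_eq_sum_single]
    simp_rw [hentry, Finset.mul_sum, mul_assoc]
  have hline : HasDerivAt (fun t : ℝ => b + t • c) c 0 := by
    simpa using ((hasDerivAt_id (0 : ℝ)).smul_const c).const_add b
  have hderiv : HasDerivAt (fun t : ℝ => sigmaK (n - 1) k (b + t • c))
      (fderiv ℝ (sigmaK (n - 1) k) b c) 0 :=
    by
    refine HasFDerivAt.comp_hasDerivAt_of_eq 0 (differentiable_sigmaK _ _ b).hasFDerivAt hline ?_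
    simp
  have hval := hderiv.unique (((hasDerivAt_sum_prod_add_mul_sq _ hb.eigenvalues).div_const
    ((n - 1).choose k : ℝ)).congr_of_eventuallyEq
      (.of_forall fun t => sigmaK_add_smul_sq hk2 hb t))
  have hzero := sigmaK_add_smul_sq hk2 hb 0
  simp only [zero_smul, add_zero, zero_mul] at hzero
  rw [hsum, hval, hzero]
  simpa using mul_rpow_le_sum_prod_mul_sum hb.eigenvalues hposdef.eigenvalues_pos hk1
    (by simpa using hk2)
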